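/- Let d, r ∈ ℕ, let I₁, I₂ be r-dimensional registers and F a flag, all pairwise disjoint. Then there exist r MLPs f₀, f₁, …, f_{r−1}, each with input dimension d, hidden dimension 2r and ternary weights, such that the composition f̄ = (id + f_{r−1}) ∘ ⋯ ∘ (id + f₀) satisfies: for any x ∈ {−1,0,1}^d with x[I₁] = bin_r(s₁) and x[I₂] = bin_r(s₂) for integers 0 ≤ s₁ ≤ s₂ < 2^r − 1 and x[F] ∈ {0,1}, one has f̄(x)[I₂] = bin_r(s₂ − s₁) if x[F] = 1 and f̄(x)[I₂] = x[I₂] if x[F] = 0; moreover all coordinates of f̄(x) at indices not in I₂ equal the corresponding coordinates of x. -/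

import Mathlib

/-- A single-hidden-layer ReLU MLP `x ↦ W₂ ReLU(W₁ x + b)` with input/output dimension `d`
and hidden dimension `dff`. -/
structure MLP (d dff : ℕ) where
  W1 : Matrix (Fin dff) (Fin d) ℝ
  b : Fin dff → ℝ
  W2 : Matrix (Fin d) (Fin dff) ℝ

/-- The hidden activations `ReLU(W₁ x + b)` of the MLP. -/
noncomputable def MLP.hidden {d dff : ℕ} (f : MLP d dff) (x : Fin d → ℝ) : Fin dff → ℝ :=
  fun h => max 0 (f.W1.mulVec x h + f.b h)

/-- The output `W₂ ReLU(W₁ x + b)` of the MLP. -/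
noncomputable def MLP.eval {d dff : ℕ} (f : MLP d dff) (x : Fin d → ℝ) : Fin d → ℝ :=
  f.W2.mulVec (f.hidden x)

/-- The MLP has ternary weights: all entries of `W₁` and `W₂` lie in `{-1,0,1}`. -/
def MLP.Ternary {d dff : ℕ} (f : MLP d dff) : Prop :=
  (∀ i j, f.W1 i j = -1 ∨ f.W1 i j = 0 ∨ f.W1 i j = 1) ∧
  (∀ i j, f.W2 i j = -1 ∨ f.W2 i j = 0 ∨ f.W2 i j = 1)

def IsTernary (a : ℝ) : Prop := a = -1 ∨ a = 0 ∨ a = 1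
def IsBit (a : ℝ) : Prop := a = 0 ∨ a = 1
def IsSign (a : ℝ) : Prop := a = -1 ∨ a = 1

/-- The ±1 binary representation of `i` with `r` bits, least significant bit first:
bit `s` is `1` if `⌊i / 2^s⌋` is odd and `-1` otherwise. -/
def binRep (r : ℕ) (i : ℕ) : Fin r → ℝ :=
  fun s => if (i / 2 ^ (s : ℕ)) % 2 = 1 then 1 else -1

/-- The sequential residual application `(id + f_{r-1}) ∘ ⋯ ∘ (id + f₀)`. -/
noncomputable def seqApply {d dff r : ℕ} (f : Fin r → MLP d dff) (x : Fin d → ℝ) :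
    Fin d → ℝ :=
  (List.ofFn fun i : Fin r => fun v : Fin d → ℝ => v + (f i).eval v).foldl
    (fun v g => g v) x

theorem binRep_eq_testBit (r t : ℕ) (j : Fin r) :
    binRep r t j = if t.testBit j then 1 else -1 := by
  simp [binRep, Nat.testBit_eq_decide_div_mod_eq]

theorem binRep_isSign (r t : ℕ) (j : Fin r) : IsSign (binRep r t j) := by
  unfold binRep
  split_ifs
  exacts [Or.inr rfl, Or.inl rfl]

/-- Subtracting `2 ^ i` from `t ≥ 2 ^ i` flips exactly the bits from position `i` up to the first
position `k ≥ i` that holds a one. -/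
theorem Nat.exists_testBit_sub_two_pow {t i : ℕ} (h : 2 ^ i ≤ t) :
    ∃ k, i ≤ k ∧ t.testBit k = true ∧ (∀ l, i ≤ l → l < k → t.testBit l = false) ∧
      ∀ j, (t - 2 ^ i).testBit j =
        if j < i then t.testBit j else if j < k then true else
          if j = k then false else t.testBit j := by
  have hq : t / 2 ^ i ≠ 0 := (Nat.div_pos h (by positivity)).ne'
  obtain ⟨m, p, ⟨u, rfl⟩, hm⟩ := Nat.exists_eq_two_pow_mul_odd hq
  have hw : t % 2 ^ i < 2 ^ i := Nat.mod_lt _ (by positivity)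
  have ht := Nat.div_add_mod t (2 ^ i)
  set w := t % 2 ^ i
  rw [hm] at ht
  have hpow : 1 ≤ 2 ^ m := Nat.one_le_two_pow
  have hsub : t - 2 ^ i = 2 ^ i * (2 ^ (m + 1) * u + (2 ^ m - 1)) + w := by
    obtain ⟨n, hn⟩ := Nat.exists_eq_add_of_le hpow
    rw [pow_succ, hn, Nat.add_sub_cancel_left, ← ht, hn]
    apply Nat.sub_eq_of_eq_add
    ring
  have ht' : t = 2 ^ i * (2 ^ (m + 1) * u + 2 ^ m) + w := by
    rw [← ht]
    ring
  have hlt : 2 ^ m - 1 < 2 ^ (m + 1) := by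
    rw [pow_succ]
    omega
  have hlt' : 2 ^ m < 2 ^ (m + 1) := by
    rw [pow_succ]
    omega
  have htb : ∀ j, t.testBit j = if j < i then w.testBit j else
      if j - i < m + 1 then decide (m = j - i) else u.testBit (j - i - (m + 1)) := fun j => by
    rw [ht', Nat.testBit_two_pow_mul_add _ hw, Nat.testBit_two_pow_mul_add _ hlt',
      Nat.testBit_two_pow]
  have hsb : ∀ j, (t - 2 ^ i).testBit j = if j < i then w.testBit j else
      if j - i < m + 1 then decide (j - i < m) else u.testBit (j - i - (m + 1)) := fun j => by
    rw [hsub, Nat.testBit_two_pow_mul_add _ hw, Nat.testBit_two_pow_mul_add _ hlt,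
      Nat.testBit_two_pow_sub_one]
  refine ⟨i + m, by omega, ?_, fun l hl hlk => ?_, fun j => ?_⟩
  · rw [htb]
    simp
  · rw [htb, if_neg (by omega), if_pos (by omega)]
    simp
    omega
  · rw [hsb, htb]
    split_ifs <;> first | rfl | omega | (simp; omega)

theorem sum_extend_mul {ι κ : Type*} [Fintype ι] [Fintype κ] {e : ι → κ}
    (he : Function.Injective e) (g : ι → ℝ) (v : κ → ℝ) :
    ∑ p, Function.extend e g 0 p * v p = ∑ q, g q * v (e q) := by
  symm
  apply Fintype.sum_of_injective e he
  · intro p hp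
    rw [Function.extend_apply' _ _ _ (by simpa using hp)]
    simp
  · intro q
    rw [he.extend_apply]

theorem isTernary_extend {ι κ : Type*} {e : ι → κ} (he : Function.Injective e) {g : ι → ℝ}
    (hg : ∀ q, IsTernary (g q)) (p : κ) : IsTernary (Function.extend e g 0 p) := by
  by_cases hp : ∃ q, e q = p
  · obtain ⟨q, rfl⟩ := hp
    rw [he.extend_apply]
    exact hg q
  · rw [Function.extend_apply' _ _ _ hp]
    exact Or.inr (Or.inl rfl)

/-- Invariants pass through a left fold over `List.ofFn`. -/
theorem foldl_ofFn_induction {α : Type*} {r : ℕ} (g : Fin r → α → α) (P : ℕ → α → Prop)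
    (step : ∀ (i : Fin r) (v : α), P i v → P (i + 1) (g i v)) {x : α} (h0 : P 0 x) :
    P r ((List.ofFn g).foldl (fun v g => g v) x) := by
  induction r generalizing P x with
  | zero => simpa using h0
  | succ r ih =>
    rw [List.ofFn_succ, List.foldl_cons]
    exact ih (fun i => g i.succ) (fun n => P (n + 1)) (fun i v h => step i.succ v h) (step 0 x h0)

section Construction

variable {d r : ℕ}

/-- The sign with which bit `l` enters the detector of the pattern `0, …, 0, 1` located at
positions `i, …, k`. -/
def borrowSign (i k l : Fin r) : ℝ :=
  if l = k then 1 else if i ≤ l ∧ l < k then -1 else 0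

/-- The effect on bit `j` of a borrow that starts at position `i` and ends at position `k`. -/
def borrowEffect (i j k : Fin r) : ℝ :=
  if i ≤ j ∧ j < k then 1 else if i ≤ k ∧ j = k then -1 else 0

theorem borrowSign_isTernary (i k l : Fin r) : IsTernary (borrowSign i k l) := by
  unfold borrowSign IsTernary
  split_ifs <;> simp

theorem borrowEffect_isTernary (i j k : Fin r) : IsTernary (borrowEffect i j k) := by
  unfold borrowEffect IsTernary
  split_ifs <;> simp

/-- The input weights of the neuron detecting that the flag and bit `i` of the first register are
set and that a borrow from position `i` of the second register ends at position `k`. -/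
def detectorWeights (i k : Fin r) : (Fin r ⊕ Fin r) ⊕ Fin 1 → ℝ :=
  Sum.elim (Sum.elim (Pi.single i 1) (borrowSign i k)) 1

theorem detectorWeights_isTernary (i k : Fin r) (q : (Fin r ⊕ Fin r) ⊕ Fin 1) :
    IsTernary (detectorWeights i k q) := by
  rcases q with (q | q) | q
  · by_cases h : q = i
    · subst h
      exact Or.inr (Or.inr (by simp [detectorWeights]))
    · exact Or.inr (Or.inl (by simp [detectorWeights, h]))
  · exact borrowSign_isTernary i k q
  · exact Or.inr (Or.inr rfl)

/-- The MLP subtracting `2 ^ i` from the second register if the flag and bit `i` of the first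
register are set. Every detector neuron occurs twice. -/
noncomputable def subtractBit (I1 I2 : Fin r → Fin d) (F : Fin d) (i : Fin r) :
    MLP d (2 * r) where
  W1 := fun h => Function.extend (Sum.elim (Sum.elim I1 I2) (fun _ : Fin 1 => F))
    (detectorWeights i (finProdFinEquiv.symm h).2) 0
  b := fun h => -(1 + ∑ l, |borrowSign i (finProdFinEquiv.symm h).2 l|)
  W2 := fun p h => Function.extend I2 (fun j => borrowEffect i j (finProdFinEquiv.symm h).2) 0 p

variable {I1 I2 : Fin r → Fin d} {F : Fin d}

theorem subtractBit_ternary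
    (hdisj : Function.Injective (Sum.elim (Sum.elim I1 I2) (fun _ : Fin 1 => F))) (i : Fin r) :
    (subtractBit I1 I2 F i).Ternary :=
  ⟨fun _ => isTernary_extend hdisj (detectorWeights_isTernary i _),
    fun p _ => isTernary_extend ((hdisj.comp Sum.inl_injective).comp Sum.inr_injective)
      (fun j => borrowEffect_isTernary i j _) p⟩

/-- The activation of the detector of a borrow from position `i` to position `k`. -/
noncomputable def detector (I1 I2 : Fin r → Fin d) (F : Fin d) (i k : Fin r) (v : Fin d → ℝ) : ℝ :=
  max 0 (v (I1 i) + ∑ l, borrowSign i k l * v (I2 l) + v F + -(1 + ∑ l, |borrowSign i k l|))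

theorem subtractBit_hidden
    (hdisj : Function.Injective (Sum.elim (Sum.elim I1 I2) (fun _ : Fin 1 => F))) (i : Fin r)
    (v : Fin d → ℝ) (h : Fin (2 * r)) :
    (subtractBit I1 I2 F i).hidden v h = detector I1 I2 F i (finProdFinEquiv.symm h).2 v := by
  have hsum : (subtractBit I1 I2 F i).W1.mulVec v h =
      ∑ q, detectorWeights i (finProdFinEquiv.symm h).2 q *
        v (Sum.elim (Sum.elim I1 I2) (fun _ : Fin 1 => F) q) :=
    sum_extend_mul hdisj _ v
  rw [MLP.hidden, hsum, detector]
  simp [Fintype.sum_sum_type, detectorWeights, Pi.single_apply, subtractBit]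

theorem detector_eq_one {i k : Fin r} {v : Fin d → ℝ} (hF : v F = 1) (h1 : v (I1 i) = 1)
    (hk : v (I2 k) = 1) (hl : ∀ l, i ≤ l → l < k → v (I2 l) = -1) :
    detector I1 I2 F i k v = 1 := by
  have : ∑ l, borrowSign i k l * v (I2 l) = ∑ l, |borrowSign i k l| := by
    refine Finset.sum_congr rfl fun l _ => ?_
    unfold borrowSign
    split_ifs with h h'
    · simp [h, hk]
    · simp [hl l h'.1 h'.2]
    · simp
  rw [detector, this, hF, h1]
  ring_nf
  simp

theorem borrowSign_mul_le (i k l : Fin r) {a : ℝ} (ha : IsSign a) :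
    borrowSign i k l * a ≤ |borrowSign i k l| := by
  refine (le_abs_self _).trans ?_
  rcases ha with rfl | rfl <;> simp

theorem sum_borrowSign_mul_le (i k : Fin r) {a : Fin r → ℝ} (ha : ∀ l, IsSign (a l)) :
    ∑ l, borrowSign i k l * a l ≤ ∑ l, |borrowSign i k l| :=
  Finset.sum_le_sum fun l _ => borrowSign_mul_le i k l (ha l)

theorem detector_eq_zero_of_inactive {i k : Fin r} {v : Fin d → ℝ} (hF : IsBit (v F))
    (h1 : IsSign (v (I1 i))) (h2 : ∀ l, IsSign (v (I2 l))) (h : ¬(v F = 1 ∧ v (I1 i) = 1)) :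
    detector I1 I2 F i k v = 0 := by
  have hle := sum_borrowSign_mul_le i k h2
  have : v (I1 i) + v F ≤ 1 := by
    rcases hF with hF | hF <;> rcases h1 with h1 | h1
    · norm_num [hF, h1]
    · norm_num [hF, h1]
    · norm_num [hF, h1]
    · exact absurd ⟨hF, h1⟩ h
  exact max_eq_left (by linarith)

theorem detector_eq_zero_of_mismatch {i k l : Fin r} {v : Fin d → ℝ} (hF : IsBit (v F))
    (h1 : IsSign (v (I1 i))) (h2 : ∀ l, IsSign (v (I2 l)))
    (h : borrowSign i k l * v (I2 l) = -1) (hl : |borrowSign i k l| = 1) :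
    detector I1 I2 F i k v = 0 := by
  have hle : ∑ l, borrowSign i k l * v (I2 l) - ∑ l, |borrowSign i k l| ≤ -2 := by
    rw [← Finset.sum_sub_distrib]
    calc ∑ l, (borrowSign i k l * v (I2 l) - |borrowSign i k l|)
        ≤ borrowSign i k l * v (I2 l) - |borrowSign i k l| := by
          rw [← Finset.add_sum_erase _ _ (Finset.mem_univ l)]
          exact add_le_of_nonpos_right (Finset.sum_nonpos fun l _ =>
            sub_nonpos.2 (borrowSign_mul_le i k l (h2 l)))
      _ = -2 := by rw [h, hl]; norm_num
  have hF' : v F ≤ 1 := by rcases hF with hF | hF <;> norm_num [hF]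
  have h1' : v (I1 i) ≤ 1 := by rcases h1 with h1 | h1 <;> norm_num [h1]
  exact max_eq_left (by linarith)

theorem subtractBit_eval_of_notMem (i : Fin r) (v : Fin d → ℝ) {p : Fin d}
    (hp : p ∉ Set.range I2) : (subtractBit I1 I2 F i).eval v p = 0 := by
  have : ∀ h, (subtractBit I1 I2 F i).W2 p h = 0 := fun h =>
    Function.extend_apply' (f := I2) (fun j => borrowEffect i j (finProdFinEquiv.symm h).2) 0 p
      (by simpa using hp)
  simp [MLP.eval, Matrix.mulVec, dotProduct, this]

theorem subtractBit_eval
    (hdisj : Function.Injective (Sum.elim (Sum.elim I1 I2) (fun _ : Fin 1 => F))) (i : Fin r)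
    (v : Fin d → ℝ) (j : Fin r) :
    (subtractBit I1 I2 F i).eval v (I2 j) =
      2 * ∑ k, borrowEffect i j k * detector I1 I2 F i k v := by
  have hI2 : Function.Injective I2 := (hdisj.comp Sum.inl_injective).comp Sum.inr_injective
  have : (subtractBit I1 I2 F i).eval v (I2 j) = ∑ h : Fin (2 * r),
      borrowEffect i j (finProdFinEquiv.symm h).2 *
        detector I1 I2 F i (finProdFinEquiv.symm h).2 v := by
    simp only [MLP.eval, Matrix.mulVec, dotProduct]
    refine Finset.sum_congr rfl fun h _ => ?_
    rw [subtractBit_hidden hdisj]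
    exact congrArg (· * _)
      (hI2.extend_apply (fun j => borrowEffect i j (finProdFinEquiv.symm h).2) 0 j)
  rw [this, Equiv.sum_comp finProdFinEquiv.symm
    (fun q : Fin 2 × Fin r => borrowEffect i j q.2 * detector I1 I2 F i q.2 v),
    Fintype.sum_prod_type, Fin.sum_univ_two, two_mul]

theorem subtractBit_eval_of_inactive
    (hdisj : Function.Injective (Sum.elim (Sum.elim I1 I2) (fun _ : Fin 1 => F))) {i : Fin r}
    {v : Fin d → ℝ} (hF : IsBit (v F)) (h1 : IsSign (v (I1 i))) (h2 : ∀ l, IsSign (v (I2 l)))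
    (h : ¬(v F = 1 ∧ v (I1 i) = 1)) (j : Fin r) :
    (subtractBit I1 I2 F i).eval v (I2 j) = 0 := by
  rw [subtractBit_eval hdisj]
  simp [detector_eq_zero_of_inactive hF h1 h2 h]

theorem subtractBit_apply_of_active
    (hdisj : Function.Injective (Sum.elim (Sum.elim I1 I2) (fun _ : Fin 1 => F))) {i : Fin r}
    {v : Fin d → ℝ} {t : ℕ} (hF : v F = 1) (h1 : v (I1 i) = 1)
    (h2 : ∀ l, v (I2 l) = binRep r t l) (hit : 2 ^ (i : ℕ) ≤ t) (htr : t < 2 ^ r) (j : Fin r) :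
    v (I2 j) + (subtractBit I1 I2 F i).eval v (I2 j) = binRep r (t - 2 ^ (i : ℕ)) j := by
  obtain ⟨k, hik, hk, hbelow, hbits⟩ := Nat.exists_testBit_sub_two_pow hit
  have hkr : k < r := by
    by_contra! hrk
    rw [Nat.testBit_lt_two_pow (htr.trans_le (Nat.pow_le_pow_right two_pos hrk))] at hk
    exact Bool.false_ne_true hk
  lift k to Fin r using hkr
  have hsign : ∀ l, IsSign (v (I2 l)) := fun l => h2 l ▸ binRep_isSign r t l
  have hvk : v (I2 k) = 1 := by rw [h2, binRep_eq_testBit, if_pos hk]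
  have hvl : ∀ l, i ≤ l → l < k → v (I2 l) = -1 := fun l hil hlk => by
    rw [h2, binRep_eq_testBit, hbelow l hil hlk]
    simp
  have hsum : ∑ k', borrowEffect i j k' * detector I1 I2 F i k' v = borrowEffect i j k := by
    rw [Finset.sum_eq_single k]
    · rw [detector_eq_one hF h1 hvk hvl, mul_one]
    · intro k' _ hne
      by_cases hik' : i ≤ k'
      · rw [mul_eq_zero]
        right
        rcases lt_or_gt_of_ne hne with hlt | hgt
        · refine detector_eq_zero_of_mismatch (l := k') (Or.inr hF) (Or.inr h1) hsign ?_ ?_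
          · simp [borrowSign, hvl k' hik' hlt]
          · simp [borrowSign]
        · have hik : i ≤ k := hik
          refine detector_eq_zero_of_mismatch (l := k) (Or.inr hF) (Or.inr h1) hsign ?_ ?_
          · simp [borrowSign, hvk, hik, hgt, hgt.ne]
          · simp [borrowSign, hik, hgt, hgt.ne]
      · have : borrowEffect i j k' = 0 := by
          unfold borrowEffect
          rw [if_neg (by omega), if_neg (by omega)]
        rw [this, zero_mul]
    · simp
  rw [subtractBit_eval hdisj, hsum, binRep_eq_testBit r (t - _), hbits]
  by_cases hji : j < i
  · have hjk : j < k := lt_of_lt_of_le hji hik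
    rw [if_pos (show (j : ℕ) < i from hji), ← binRep_eq_testBit, ← h2, borrowEffect, if_neg (by omega),
      if_neg (by omega)]
    ring
  rw [if_neg (show ¬(j : ℕ) < i from hji)]
  push Not at hji
  rcases lt_trichotomy j k with hjk | rfl | hjk
  · rw [if_pos (show (j : ℕ) < k from hjk), hvl j hji hjk, borrowEffect, if_pos ⟨hji, hjk⟩]
    norm_num
  · rw [hvk, borrowEffect, if_neg (by omega), if_pos ⟨hji, rfl⟩]
    norm_num
  · rw [if_neg (show ¬(j : ℕ) < k from hjk.asymm), if_neg (show ¬(j : ℕ) = k by omega),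
      ← binRep_eq_testBit, ← h2, borrowEffect, if_neg (by omega), if_neg (by omega)]
    ring

end Construction

/-- Full subtraction lemma: there exist `r` ternary MLPs `f₀,…,f_{r−1}`, each of hidden
dimension `2r`, such that `f̄ = (id + f_{r−1}) ∘ ⋯ ∘ (id + f₀)` maps any ternary input
with `x[I₁] = bin_r(s₁)`, `x[I₂] = bin_r(s₂)`, `0 ≤ s₁ ≤ s₂ < 2^r − 1` and binary flag
`x[F]` to a vector with `f̄(x)[I₂] = bin_r(s₂ − s₁)` if `x[F] = 1` and
`f̄(x)[I₂] = x[I₂]` if `x[F] = 0`, while leaving all coordinates outside `I₂`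
unchanged. -/
theorem full_subtraction_mlp (d r : ℕ) (I1 I2 : Fin r → Fin d) (F : Fin d)
    (hdisj : Function.Injective (Sum.elim (Sum.elim I1 I2) (fun _ : Fin 1 => F))) :
    ∃ f : Fin r → MLP d (2 * r), (∀ i, (f i).Ternary) ∧
      ∀ x : Fin d → ℝ, (∀ i, IsTernary (x i)) →
        ∀ s1 s2 : ℕ, s1 ≤ s2 → s2 < 2 ^ r - 1 →
          (∀ t, x (I1 t) = binRep r s1 t) → (∀ t, x (I2 t) = binRep r s2 t) →
          IsBit (x F) →
          (x F = 1 → ∀ t, seqApply f x (I2 t) = binRep r (s2 - s1) t) ∧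
          (x F = 0 → ∀ t, seqApply f x (I2 t) = x (I2 t)) ∧
          (∀ i, i ∉ Set.range I2 → seqApply f x i = x i) := by
  have hI1 : ∀ t, I1 t ∉ Set.range I2 := by
    rintro t ⟨s, hs⟩
    simpa using @hdisj (Sum.inl (Sum.inr s)) (Sum.inl (Sum.inl t)) hs
  have hFI2 : F ∉ Set.range I2 := by
    rintro ⟨s, hs⟩
    simpa using @hdisj (Sum.inl (Sum.inr s)) (Sum.inr 0) hs
  refine ⟨subtractBit I1 I2 F, subtractBit_ternary hdisj, ?_⟩
  intro x _ s1 s2 hs hs2 hx1 hx2 hxF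
  have hinv : (∀ p, p ∉ Set.range I2 → seqApply (subtractBit I1 I2 F) x p = x p) ∧
      ∀ t, seqApply (subtractBit I1 I2 F) x (I2 t) =
        binRep r (if x F = 1 then s2 - s1 % 2 ^ r else s2) t := by
    refine foldl_ofFn_induction _ (fun n (v : Fin d → ℝ) => (∀ p, p ∉ Set.range I2 → v p = x p) ∧
      ∀ t, v (I2 t) = binRep r (if x F = 1 then s2 - s1 % 2 ^ n else s2) t) ?_ ?_
    · rintro i v ⟨hout, hin⟩
      refine ⟨fun p hp => ?_, fun j => ?_⟩
      · rw [Pi.add_apply, subtractBit_eval_of_notMem i v hp, add_zero, hout p hp]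
      have hvF : v F = x F := hout F hFI2
      have hv1 : v (I1 i) = if s1.testBit i then 1 else -1 := by
        rw [hout _ (hI1 i), hx1, binRep_eq_testBit]
      have hsplit : s1 % 2 ^ ((i : ℕ) + 1) =
          s1 % 2 ^ (i : ℕ) + 2 ^ (i : ℕ) * (s1.testBit i).toNat := by
        rw [Nat.mod_pow_succ, Nat.toNat_testBit]
      have hmod : s1 % 2 ^ ((i : ℕ) + 1) ≤ s1 := Nat.mod_le _ _
      rw [Pi.add_apply]
      by_cases hact : x F = 1 ∧ s1.testBit i = true
      · simp only [if_pos hact.1] at hin ⊢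
        rw [hact.2, Bool.toNat_true, mul_one] at hsplit
        rw [subtractBit_apply_of_active hdisj (hvF.trans hact.1) (by rw [hv1, if_pos hact.2]) hin
          (by omega) (by omega), hsplit, Nat.sub_sub]
      · rw [subtractBit_eval_of_inactive hdisj (hvF ▸ hxF)
          (hout _ (hI1 i) ▸ hx1 i ▸ binRep_isSign r s1 i)
          (fun l => hin l ▸ binRep_isSign r _ l), add_zero, hin]
        · by_cases hF1 : x F = 1
          · have hbit : s1.testBit i = false := by simpa [hF1] using hact
            rw [if_pos hF1, if_pos hF1, hsplit, hbit]
            simp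
          · rw [if_neg hF1, if_neg hF1]
        · rintro ⟨hF1, hb⟩
          refine hact ⟨hvF ▸ hF1, ?_⟩
          by_contra hne
          rw [hv1, if_neg hne] at hb
          norm_num at hb
    · refine ⟨fun _ _ => rfl, fun t => ?_⟩
      simp [hx2, Nat.mod_one]
  refine ⟨fun hF t => ?_, fun hF t => ?_, hinv.1⟩
  · rw [hinv.2, if_pos hF, Nat.mod_eq_of_lt (by omega)]
  · rw [hinv.2, if_neg (by rw [hF]; norm_num), hx2]
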